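/- Let z₁,…,z_q ∈ ℂ^p with ‖z_i‖₂² ≤ δ for all i, and suppose α·I_p ≤ ∑_{i=1}^q z_i z_i* ≤ β·I_p in the Loewner order, where β ≥ α > 100·δ > 0. Then there is a partition of {1,…,q} into sets J₁,…,J_t such that for every s ≤ t one has 25·δ·I_p ≤ ∑_{i∈J_s} z_i z_i* ≤ 3600·(β/α)·δ·I_p. -/

import Mathlib

/-!
Statement 12 (iterated Kadison–Singer / Weaver subsampling, finite version):
Let `z₁,…,z_q ∈ ℂ^p` with `‖z_i‖₂² ≤ δ` and `α I_p ≤ ∑ z_i z_i* ≤ β I_p` in the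
Loewner order, where `β ≥ α > 100 δ > 0`.  Then there is a partition of `{1,…,q}`
into sets `J₁,…,J_t` such that for every `s ≤ t`,
`25 δ I_p ≤ ∑_{i∈J_s} z_i z_i* ≤ 3600 (β/α) δ I_p`.
-/

open scoped ComplexConjugate ComplexOrder

noncomputable section

/-- The rank-one matrix `z z*`, with entries `(z z*)_{k,l} = z_k conj (z_l)`. -/
def rankOneMatrix {p : ℕ} (z : Fin p → ℂ) : Matrix (Fin p) (Fin p) ℂ :=
  Matrix.vecMulVec z (star z)

namespace MSS

/-- Real algebra behind the barrier step. -/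
lemma barrier_algebra (c0 c1 c2 d0 d1 d2 h : ℝ) (hc0 : 0 < c0) (hc1 : 0 ≤ c1) (hc2 : 0 ≤ c2)
    (h0 : 0 ≤ h) (h1 : h ≤ 1 / 2)
    (hW : ∀ τ : ℝ, 0 ≤ (d0 + d1 * τ + d2 * τ ^ 2) * (c1 + 2 * c2 * τ)
      - (c0 + c1 * τ + c2 * τ ^ 2) * (d1 + 2 * d2 * τ))
    (δ : ℝ) (hδ : δ = 1 / 2 + h)
    (hB : d0 ≤ h * c0)
    (hA : c1 + 2 * c2 * δ ≤ 2 * h * (c0 + c1 * δ + c2 * δ ^ 2)) :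
    (d0 + d1 * δ + d2 * δ ^ 2) - (d1 + 2 * d2 * δ) / 2 ≤
      h * ((c0 + c1 * δ + c2 * δ ^ 2) - (c1 + 2 * c2 * δ) / 2) := by
  have hδp : 0 < δ := by linarith
  obtain ⟨a0, ha0⟩ : ∃ a0, a0 = c0 + c1 * δ + c2 * δ ^ 2 := ⟨_, rfl⟩
  obtain ⟨a1, ha1⟩ : ∃ a1, a1 = c1 + 2 * c2 * δ := ⟨_, rfl⟩
  obtain ⟨b0, hb0⟩ : ∃ b0, b0 = d0 + d1 * δ + d2 * δ ^ 2 := ⟨_, rfl⟩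
  obtain ⟨b1, hb1⟩ : ∃ b1, b1 = d1 + 2 * d2 * δ := ⟨_, rfl⟩
  rw [← ha0, ← ha1] at hA
  rw [← ha0, ← ha1, ← hb0, ← hb1]
  have ec1 : c1 = a1 - 2 * c2 * δ := by rw [ha1]; ring
  have ec0 : c0 = a0 - a1 * δ + c2 * δ ^ 2 := by rw [ha0, ha1]; ring
  have ed1 : d1 = b1 - 2 * d2 * δ := by rw [hb1]; ring
  have ed0 : d0 = b0 - b1 * δ + d2 * δ ^ 2 := by rw [hb0, hb1]; ring
  have ha0p : 0 < a0 := by rw [ha0]; positivity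
  have ha1p : 0 ≤ a1 := by rw [ha1]; positivity
  obtain ⟨w0, hw0⟩ : ∃ w0, w0 = b0 * a1 - a0 * b1 := ⟨_, rfl⟩
  obtain ⟨w1, hw1⟩ : ∃ w1, w1 = 2 * (b0 * c2 - a0 * d2) := ⟨_, rfl⟩
  obtain ⟨w2, hw2⟩ : ∃ w2, w2 = b1 * c2 - a1 * d2 := ⟨_, rfl⟩
  have hWq : ∀ x : ℝ, 0 ≤ w2 * (x * x) + w1 * x + w0 := by
    intro x
    have := hW (δ + x)
    rw [ec1, ec0, ed1, ed0] at this
    rw [hw0, hw1, hw2]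
    linarith [this]
  have hdisc : w1 ^ 2 ≤ 4 * w2 * w0 := by
    have := discrim_le_zero hWq
    unfold discrim at this
    linarith
  have hw0p : 0 ≤ w0 := by simpa using hWq 0
  have hrel : a0 * w2 + c2 * w0 = a1 * w1 / 2 := by rw [hw0, hw1, hw2]; ring
  -- key : tangent inequality
  have key : a0 * w1 / 2 ≤ w0 * (a1 - c2 * δ) := by
    have hm : 0 ≤ a1 - 2 * c2 * δ := by rw [← ec1]; exact hc1
    by_contra hcon
    push Not at hcon
    have hw0pos : 0 < w0 := by
      rcases hw0p.lt_or_eq with h | h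
      · exact h
      · exfalso
        rw [← h] at hcon hdisc
        have : w1 = 0 := by nlinarith
        rw [this] at hcon; simp at hcon
    -- (a0 w1 - a1 w0)^2 ≤ (a1^2 - 4 a0 c2) w0^2
    have e1 : (a0 * w1 - a1 * w0) ^ 2 ≤ (a1 ^ 2 - 4 * a0 * c2) * w0 ^ 2 := by
      have := mul_le_mul_of_nonneg_left hdisc (mul_nonneg ha0p.le ha0p.le)
      have e : a0 * w2 = a1 * w1 / 2 - c2 * w0 := by linarith
      have : a0 * a0 * (4 * w2 * w0) = 4 * a0 * w0 * (a1 * w1 / 2 - c2 * w0) := by rw [← e]; ring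
      linarith
    have e2 : (a1 - 2 * c2 * δ) * w0 < a0 * w1 - a1 * w0 := by linarith
    have e3 : ((a1 - 2 * c2 * δ) * w0) ^ 2 < (a0 * w1 - a1 * w0) ^ 2 :=
      pow_lt_pow_left₀ e2 (by positivity) (by norm_num)
    have e4 : (a1 ^ 2 - 4 * a0 * c2) ≤ (a1 - 2 * c2 * δ) ^ 2 := by
      have : 0 ≤ c2 * c0 := by positivity
      rw [ec0] at this; linarith
    have e5 := mul_le_mul_of_nonneg_right e4 (sq_nonneg w0)
    linarith
  -- d0/c0 ≥ b0/a0 + δ w0 / a0^2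
  have t1 : c0 * (a0 * b0 + δ * w0) ≤ d0 * a0 ^ 2 := by
    have : d0 * a0 ^ 2 - c0 * (a0 * b0 + δ * w0) = δ ^ 2 * (w0 * (a1 - c2 * δ) - a0 * w1 / 2) := by
      rw [ec0, ed0, hw0, hw1]; ring
    have : 0 ≤ δ ^ 2 * (w0 * (a1 - c2 * δ) - a0 * w1 / 2) :=
      mul_nonneg (sq_nonneg _) (by linarith)
    linarith
  have t2 : a0 * b0 + δ * w0 ≤ h * a0 ^ 2 := by
    have : d0 * a0 ^ 2 ≤ h * c0 * a0 ^ 2 := mul_le_mul_of_nonneg_right hB (sq_nonneg _)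
    have : c0 * (a0 * b0 + δ * w0) ≤ c0 * (h * a0 ^ 2) := by linarith
    exact le_of_mul_le_mul_left this hc0
  have hden : (1 - h) * a0 ≤ a0 - a1 / 2 := by linarith
  have hdenp : 0 < a0 - a1 / 2 := by nlinarith
  have t3 : a0 / 2 ≤ δ * (a0 - a1 / 2) := by
    have : a0 / 2 ≤ δ * ((1 - h) * a0) := by
      rw [hδ]; nlinarith [mul_nonneg (mul_nonneg h0 (by linarith : (0:ℝ) ≤ 1 / 2 - h)) ha0p.le]
    exact this.trans (mul_le_mul_of_nonneg_left hden hδp.le)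
  -- a0^2 (b0 - b1/2) = a0 b0 (a0 - a1/2) + a0 w0/2
  have t4 : a0 ^ 2 * (b0 - b1 / 2) ≤ a0 ^ 2 * (h * (a0 - a1 / 2)) := by
    have e : a0 ^ 2 * (b0 - b1 / 2) = a0 * b0 * (a0 - a1 / 2) + a0 / 2 * w0 := by rw [hw0]; ring
    have := mul_le_mul_of_nonneg_right t3 hw0p
    have := mul_le_mul_of_nonneg_right t2 hdenp.le
    linarith [mul_le_mul_of_nonneg_left this ha0p.le]
  exact le_of_mul_le_mul_left t4 (by positivity)

variable {κ : Type*} [DecidableEq κ]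

/-- Multi-affine, real, stable, with monic diagonal restrictions of degree `d`. -/
structure Good (d : ℕ) (f : (κ → ℂ) → ℂ) : Prop where
  cont : Continuous f
  aff : ∀ (z : κ → ℂ) (k : κ) (t : ℂ),
    f (z + Pi.single k t) = f z + t * (f (z + Pi.single k 1) - f z)
  real : ∀ z : κ → ℂ, f (star z) = star (f z)
  stable : ∀ z : κ → ℂ, (∀ k, 0 < (z k).im) → f z ≠ 0
  monic : ∀ w : κ → ℂ, ∃ P : Polynomial ℂ, P.Monic ∧ P.natDegree = d ∧
    ∀ x : ℂ, P.eval x = f (fun k => x + w k)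

/-- The averaging operator. -/
def T (a b : κ) (s : ℝ) (f : (κ → ℂ) → ℂ) : (κ → ℂ) → ℂ := fun z =>
  ((1 - s : ℝ) : ℂ) * f (z - Pi.single a 1) + ((s : ℝ) : ℂ) * f (z - Pi.single b 1)

lemma star_single_one (a : κ) : star (Pi.single a (1 : ℂ) : κ → ℂ) = Pi.single a 1 := by
  ext k
  by_cases h : k = a
  · subst h; simp
  · simp [h]

lemma im_ratio_aux (A B : ℂ) (η : ℝ) (h : ∀ s : ℂ, -η < s.im → A + s * B ≠ 0) (hB : B ≠ 0) :
    η ≤ (A / B).im := by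
  by_contra hc
  push Not at hc
  refine h (-(A / B)) (by simpa using hc) ?_
  field_simp; ring

lemma im_inv_aux (A B : ℂ) (η : ℝ) (hη : 0 < η) (h : ∀ s : ℂ, -η < s.im → A + s * B ≠ 0)
    (hB : B ≠ 0) : (B / A).im < 0 := by
  have h1 := im_ratio_aux A B η h hB
  have : B / A = (A / B)⁻¹ := by simp
  rw [this, Complex.inv_im]
  have hp : 0 < (A / B).im := by linarith
  have : A / B ≠ 0 := by intro h0; rw [h0] at hp; simp at hp
  exact div_neg_of_neg_of_pos (by linarith) (Complex.normSq_pos.mpr this)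

lemma Good.aff_sub {d : ℕ} {f : (κ → ℂ) → ℂ} (hf : Good d f) (z : κ → ℂ) (k : κ) :
    f (z - Pi.single k 1) = f z - (f (z + Pi.single k 1) - f z) := by
  have := hf.aff z k (-1)
  rw [Pi.single_neg, ← sub_eq_add_neg] at this
  rw [this]; ring

lemma Good.im_partial {d : ℕ} {f : (κ → ℂ) → ℂ} (hf : Good d f) (z : κ → ℂ)
    (hz : ∀ k, 0 < (z k).im) (a : κ) (h : f (z + Pi.single a 1) - f z ≠ 0) :
    ((f (z + Pi.single a 1) - f z) / f z).im < 0 := by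
  refine im_inv_aux _ _ (z a).im (hz a) ?_ h
  intro s hs
  rw [← hf.aff]
  apply hf.stable
  intro k
  by_cases hk : k = a
  · subst hk; simp; linarith
  · simp [hk, hz]

lemma monic_comb (d : ℕ) (P Q : Polynomial ℂ) (hP : P.Monic) (hQ : Q.Monic)
    (dP : P.natDegree = d) (dQ : Q.natDegree = d) (u v : ℂ) (huv : u + v = 1) :
    (Polynomial.C u * P + Polynomial.C v * Q).Monic ∧
    (Polynomial.C u * P + Polynomial.C v * Q).natDegree = d := by
  have hle : (Polynomial.C u * P + Polynomial.C v * Q).natDegree ≤ d := by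
    refine (Polynomial.natDegree_add_le _ _).trans (max_le ?_ ?_)
    · exact (Polynomial.natDegree_C_mul_le _ _).trans dP.le
    · exact (Polynomial.natDegree_C_mul_le _ _).trans dQ.le
  have hc : (Polynomial.C u * P + Polynomial.C v * Q).coeff d = 1 := by
    have h1 : P.coeff d = 1 := by rw [← dP]; exact hP
    have h2 : Q.coeff d = 1 := by rw [← dQ]; exact hQ
    simp [h1, h2, huv]
  refine ⟨Polynomial.monic_of_natDegree_le_of_coeff_eq_one d hle hc, ?_⟩
  exact Polynomial.natDegree_eq_of_le_of_coeff_ne_zero hle (by rw [hc]; exact one_ne_zero)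

lemma Good.shift {d : ℕ} {f : (κ → ℂ) → ℂ} (hf : Good d f) {a b : κ} {s : ℝ}
    (h0 : 0 ≤ s) (h1 : s ≤ 1) : Good d (T a b s f) where
  cont := by
    unfold T
    have := hf.cont
    fun_prop
  aff := by
    intro z k t
    have ha := hf.aff (z - Pi.single a 1) k t
    have hb := hf.aff (z - Pi.single b 1) k t
    simp only [T]
    rw [add_sub_right_comm, add_sub_right_comm, ha, hb, add_sub_right_comm z (Pi.single k 1),
      add_sub_right_comm z (Pi.single k 1)]
    ring
  real := by
    intro z
    have ha := hf.real (z - Pi.single a 1)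
    have hb := hf.real (z - Pi.single b 1)
    rw [star_sub, star_single_one] at ha hb
    simp only [T, ha, hb]
    simp
  stable := by
    intro z hz
    have hfz := hf.stable z hz
    simp only [T, hf.aff_sub]
    intro h
    set A := f z
    set Ba := f (z + Pi.single a 1) - f z with hBa
    set Bb := f (z + Pi.single b 1) - f z with hBb
    have ia : Ba ≠ 0 → (Ba / A).im < 0 := hf.im_partial z hz a
    have ib : Bb ≠ 0 → (Bb / A).im < 0 := hf.im_partial z hz b
    have e : ((1 - s : ℝ) : ℂ) * (Ba / A) + (s : ℂ) * (Bb / A) = 1 := by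
      field_simp
      push_cast at h ⊢
      linear_combination -h
    have ei := congrArg Complex.im e
    rw [Complex.add_im, Complex.im_ofReal_mul, Complex.im_ofReal_mul, Complex.one_im] at ei
    have er := congrArg Complex.re e
    rw [Complex.add_re, Complex.re_ofReal_mul, Complex.re_ofReal_mul, Complex.one_re] at er
    have ia' : (Ba / A).im ≤ 0 := by
      by_cases h : Ba = 0
      · simp [h]
      · exact (ia h).le
    have ib' : (Bb / A).im ≤ 0 := by
      by_cases h : Bb = 0
      · simp [h]
      · exact (ib h).le
    have pa : (1 - s) * (Ba / A).im ≤ 0 := mul_nonpos_of_nonneg_of_nonpos (by linarith) ia'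
    have pb : s * (Bb / A).im ≤ 0 := mul_nonpos_of_nonneg_of_nonpos h0 ib'
    have za : (1 - s) * (Ba / A).im = 0 := by linarith
    have zb : s * (Bb / A).im = 0 := by linarith
    have ra : (1 - s) * (Ba / A).re = 0 := by
      rcases mul_eq_zero.mp za with h | h
      · rw [h]; simp
      · by_cases hB : Ba = 0
        · simp [hB]
        · exact absurd h (ia hB).ne
    have rb : s * (Bb / A).re = 0 := by
      rcases mul_eq_zero.mp zb with h | h
      · rw [h]; simp
      · by_cases hB : Bb = 0
        · simp [hB]
        · exact absurd h (ib hB).ne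
    linarith
  monic := by
    intro w
    obtain ⟨P, hP, dP, eP⟩ := hf.monic (w - Pi.single a 1)
    obtain ⟨Q, hQ, dQ, eQ⟩ := hf.monic (w - Pi.single b 1)
    have := monic_comb d P Q hP hQ dP dQ ((1 - s : ℝ) : ℂ) (s : ℂ) (by push_cast; ring)
    refine ⟨_, this.1, this.2, ?_⟩
    intro x
    simp only [Polynomial.eval_add, Polynomial.eval_mul, Polynomial.eval_C, eP, eQ, T]
    congr 3 <;> · ext k; simp [add_sub_assoc]

/-- Value at a real point. -/
def rv (f : (κ → ℂ) → ℂ) (y : κ → ℝ) : ℝ := (f (fun k => (y k : ℂ))).re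

lemma Good.ofReal {d : ℕ} {f : (κ → ℂ) → ℂ} (hf : Good d f) (y : κ → ℝ) :
    f (fun k => (y k : ℂ)) = (rv f y : ℂ) := by
  have h := hf.real (fun k => (y k : ℂ))
  have e : star (fun k => (y k : ℂ)) = fun k => (y k : ℂ) := by ext k; simp
  rw [e] at h
  exact (Complex.conj_eq_iff_re.mp h.symm).symm

lemma cast_add_single (y : κ → ℝ) (k : κ) (t : ℝ) :
    (fun j => (((y + Pi.single k t : κ → ℝ) j : ℝ) : ℂ)) = (fun j => (y j : ℂ)) + Pi.single k (t : ℂ) := by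
  ext j
  by_cases h : j = k
  · subst h; simp
  · simp [h]

lemma Good.raff {d : ℕ} {f : (κ → ℂ) → ℂ} (hf : Good d f) (y : κ → ℝ) (k : κ) (t : ℝ) :
    rv f (y + Pi.single k t) = rv f y + t * (rv f (y + Pi.single k 1) - rv f y) := by
  have h := hf.aff (fun j => (y j : ℂ)) k t
  have h1 := cast_add_single y k 1
  rw [Complex.ofReal_one] at h1
  rw [← cast_add_single, ← h1, hf.ofReal, hf.ofReal, hf.ofReal] at h
  exact_mod_cast h

/-- Rayleigh inequality. -/
lemma Good.rayleigh {d : ℕ} {f : (κ → ℂ) → ℂ} (hf : Good d f) (y : κ → ℝ) (a k : κ) (hak : a ≠ k) :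
    rv f y * (rv f (y + Pi.single k 1 + Pi.single a 1) - rv f (y + Pi.single k 1)
      - (rv f (y + Pi.single a 1) - rv f y)) ≤
    (rv f (y + Pi.single a 1) - rv f y) * (rv f (y + Pi.single k 1) - rv f y) := by
  set Y : κ → ℂ := fun j => (y j : ℂ) with hY
  let Z : ℝ → κ → ℂ := fun η j => (y j : ℂ) + η * Complex.I
  let A : ℝ → ℂ := fun η => f (Z η + Pi.single a Complex.I)
  let B : ℝ → ℂ := fun η => f (Z η + Pi.single a Complex.I + Pi.single k 1) - A η
  have hZc : Continuous Z := by
    refine continuous_pi fun j => ?_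
    fun_prop
  have hfc := hf.cont
  have hAc : Continuous A := by fun_prop
  have hBc : Continuous B := by fun_prop
  have hpos : ∀ η : ℝ, 0 < η → 0 ≤ (A η * conj (B η)).im := by
    intro η hη
    by_cases hB : B η = 0
    · simp [hB]
    have := im_ratio_aux (A η) (B η) η ?_ hB
    · have e : A η * conj (B η) = (A η / B η) * (Complex.normSq (B η) : ℂ) := by
        rw [← Complex.mul_conj]; field_simp
      rw [e, Complex.im_mul_ofReal]
      exact mul_nonneg (by linarith) (Complex.normSq_nonneg _)
    · intro s hs
      have := hf.aff (Z η + Pi.single a Complex.I) k s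
      change f _ = A η + s * B η at this
      rw [← this]
      apply hf.stable
      intro j
      by_cases hja : j = a
      · subst hja
        simp [Z, hak]; linarith
      · by_cases hjk : j = k
        · subst hjk
          simp [Z, hja]; linarith
        · simp [Z, hja, hjk, hη]
  have hlim : 0 ≤ (A 0 * conj (B 0)).im := by
    have hc : Continuous fun η => (A η * conj (B η)).im := by fun_prop
    have ht : Filter.Tendsto (fun η => (A η * conj (B η)).im) (nhdsWithin 0 (Set.Ioi 0))
      (nhds (A 0 * conj (B 0)).im) := hc.continuousAt.tendsto.mono_left nhdsWithin_le_nhds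
    refine ge_of_tendsto ht ?_
    filter_upwards [self_mem_nhdsWithin] with η hη using hpos η hη
  have hZ0 : Z 0 = Y := by ext j; simp [Z, hY]
  have c1 : ∀ (x : κ → ℝ) (j : κ), (fun i => (x i : ℂ)) + Pi.single j (1 : ℂ)
      = fun i => (((x + Pi.single j 1 : κ → ℝ) i : ℝ) : ℂ) := by
    intro x j
    rw [cast_add_single]; simp
  have eA : A 0 = (rv f y : ℂ) + Complex.I * ((rv f (y + Pi.single a 1) : ℂ) - rv f y) := by
    simp only [A, hZ0]
    rw [hf.aff, hY, c1, hf.ofReal, hf.ofReal]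
  have eAB : f (Z 0 + Pi.single a Complex.I + Pi.single k 1) = (rv f (y + Pi.single k 1) : ℂ) +
      Complex.I * ((rv f (y + Pi.single k 1 + Pi.single a 1) : ℂ) - rv f (y + Pi.single k 1)) := by
    rw [hZ0, add_right_comm, hf.aff, hY, c1, c1, hf.ofReal, hf.ofReal]
  have eB : B 0 = ((rv f (y + Pi.single k 1) - rv f y : ℝ) : ℂ) +
      Complex.I * ((rv f (y + Pi.single k 1 + Pi.single a 1) - rv f (y + Pi.single k 1)
      - (rv f (y + Pi.single a 1) - rv f y) : ℝ) : ℂ) := by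
    simp only [B]
    rw [eAB, eA]
    push_cast; ring
  rw [eA, eB] at hlim
  simp at hlim
  linarith

end MSS

namespace MSS

variable {κ : Type*} [DecidableEq κ]

lemma Good.raff2 {d : ℕ} {f : (κ → ℂ) → ℂ} (hf : Good d f) (y : κ → ℝ) (a b : κ) (s t : ℝ) :
    rv f (y + Pi.single a s + Pi.single b t) = rv f y + s * (rv f (y + Pi.single a 1) - rv f y)
      + t * (rv f (y + Pi.single b 1) - rv f y)
      + s * t * (rv f (y + Pi.single a 1 + Pi.single b 1) - rv f (y + Pi.single a 1)
        - rv f (y + Pi.single b 1) + rv f y) := by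
  have e1 := hf.raff (y + (Pi.single a s : κ → ℝ)) b t
  have e2 := hf.raff (y + (Pi.single b 1 : κ → ℝ)) a s
  have e3 := hf.raff y a s
  rw [add_right_comm y (Pi.single a s) (Pi.single b 1)] at e1
  rw [add_right_comm y (Pi.single b 1) (Pi.single a 1)] at e2
  rw [e1, e2, e3]
  ring

/-- Barrier invariant above `ζ`, for the coordinates in `K`. -/
def Inv (f : (κ → ℂ) → ℂ) (ζ : κ → ℝ) (h : ℝ) (K : Set κ) : Prop :=
  ∀ y : κ → ℝ, ζ ≤ y → 0 < rv f y ∧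
    ∀ k ∈ K, rv f (y + Pi.single k 1) - rv f y ≤ h * rv f y

lemma le_add_single {ζ y : κ → ℝ} (hy : ζ ≤ y) (k : κ) {t : ℝ} (ht : 0 ≤ t) :
    ζ ≤ y + Pi.single k t := by
  have : (0 : κ → ℝ) ≤ Pi.single k t := Pi.single_nonneg.mpr ht
  exact le_add_of_le_of_nonneg hy this

lemma slope_nonneg {u v : ℝ} (h : ∀ t : ℝ, 0 ≤ t → 0 ≤ u + t * v) : 0 ≤ v := by
  by_contra hc
  push Not at hc
  have h0 := h 0 le_rfl
  have := h ((u + 1) / (-v)) (div_nonneg (by linarith) (by linarith))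
  have e : (u + 1) / (-v) * v = -(u + 1) := by
    have : v ≠ 0 := hc.ne
    field_simp
  linarith

lemma Inv.d1 {d : ℕ} {f : (κ → ℂ) → ℂ} (hf : Good d f) {ζ : κ → ℝ} {h : ℝ} {K : Set κ}
    (hI : Inv f ζ h K) {y : κ → ℝ} (hy : ζ ≤ y) (k : κ) :
    0 ≤ rv f (y + Pi.single k 1) - rv f y := by
  refine slope_nonneg (u := rv f y) fun t ht => ?_
  rw [← hf.raff]
  exact (hI _ (le_add_single hy k ht)).1.le

lemma Inv.d2 {d : ℕ} {f : (κ → ℂ) → ℂ} (hf : Good d f) {ζ : κ → ℝ} {h : ℝ} {K : Set κ}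
    (hI : Inv f ζ h K) {y : κ → ℝ} (hy : ζ ≤ y) (a b : κ) :
    0 ≤ rv f (y + Pi.single a 1 + Pi.single b 1) - rv f (y + Pi.single a 1)
        - rv f (y + Pi.single b 1) + rv f y := by
  refine slope_nonneg (u := rv f (y + Pi.single a 1) - rv f y) fun t ht => ?_
  have h1 := Inv.d1 hf hI (le_add_single hy b ht) a
  rw [add_right_comm, hf.raff2, hf.raff y b t] at h1
  linarith

lemma Good.rv_T {d : ℕ} {f : (κ → ℂ) → ℂ} (hf : Good d f) (a b : κ) (s : ℝ) (y : κ → ℝ) :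
    rv (T a b s f) y = rv f y - (1 - s) * (rv f (y + Pi.single a 1) - rv f y)
      - s * (rv f (y + Pi.single b 1) - rv f y) := by
  have c : ∀ j : κ, (fun i => (y i : ℂ)) - Pi.single j (1 : ℂ)
      = fun i => (((y + Pi.single j (-1) : κ → ℝ) i : ℝ) : ℂ) := by
    intro j
    rw [cast_add_single]
    ext i
    by_cases h : i = j
    · subst h; simp [sub_eq_add_neg]
    · simp [h]
  have e : rv (T a b s f) y =
      (1 - s) * rv f (y + Pi.single a (-1)) + s * rv f (y + Pi.single b (-1)) := by
    unfold rv T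
    rw [c, c, Complex.add_re, Complex.re_ofReal_mul, Complex.re_ofReal_mul]
  rw [e, hf.raff, hf.raff y b]
  ring

lemma barrier_step {d : ℕ} {f : (κ → ℂ) → ℂ} (hf : Good d f) {ζ : κ → ℝ} {h : ℝ} {K : Set κ}
    (hI : Inv f ζ h K) (h0 : 0 ≤ h) (h1 : h ≤ 1 / 2) {a b : κ} (ha : a ∈ K) (hb : b ∈ K) :
    Inv (T a b (1 / 2) f) (ζ + Pi.single a (1 / 2 + h) + Pi.single b (1 / 2 + h)) h
      (K \ {a, b}) := by
  intro y hy
  obtain ⟨δ, hδ⟩ : ∃ δ : ℝ, δ = 1 / 2 + h := ⟨_, rfl⟩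
  rw [← hδ] at hy
  obtain ⟨x, hx⟩ : ∃ x, x = y - Pi.single b δ - Pi.single a δ := ⟨_, rfl⟩
  have hyx : y = x + Pi.single a δ + Pi.single b δ := by rw [hx]; abel
  have hζx : ζ ≤ x := by
    rw [hyx] at hy
    exact le_of_add_le_add_right (le_of_add_le_add_right hy)
  have hδ0 : 0 ≤ δ := by linarith
  have hζy : ζ ≤ y := by
    rw [hyx]; exact le_add_single (le_add_single hζx a hδ0) b hδ0
  obtain ⟨p0, pk⟩ := hI y hζy
  have pa := pk a ha
  have pb := pk b hb
  rw [hf.rv_T]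
  refine ⟨by nlinarith, ?_⟩
  intro k hk
  obtain ⟨hkK, hkab⟩ := hk
  have hka : a ≠ k := by rintro rfl; simp at hkab
  have hkb : b ≠ k := by rintro rfl; simp at hkab
  rw [hf.rv_T]
  -- coefficients
  have hx0 := (hI x hζx).1
  have hxk := (hI x hζx).2 k hkK
  have qa := Inv.d1 hf hI hζx a
  have qb := Inv.d1 hf hI hζx b
  have qab := Inv.d2 hf hI hζx a b
  obtain ⟨c0, hc0⟩ : ∃ c0, c0 = rv f x := ⟨_, rfl⟩
  obtain ⟨ca, hca⟩ : ∃ ca, ca = rv f (x + Pi.single a 1) - rv f x := ⟨_, rfl⟩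
  obtain ⟨cb, hcb⟩ : ∃ ca, ca = rv f (x + Pi.single b 1) - rv f x := ⟨_, rfl⟩
  obtain ⟨c2, hc2⟩ : ∃ c2, c2 = rv f (x + Pi.single a 1 + Pi.single b 1)
    - rv f (x + Pi.single a 1) - rv f (x + Pi.single b 1) + rv f x := ⟨_, rfl⟩
  obtain ⟨x', hx'⟩ : ∃ x', x' = x + Pi.single k (1 : ℝ) := ⟨_, rfl⟩
  obtain ⟨e0, he0⟩ : ∃ c0, c0 = rv f x' := ⟨_, rfl⟩
  obtain ⟨ea, hea⟩ : ∃ ca, ca = rv f (x' + Pi.single a 1) - rv f x' := ⟨_, rfl⟩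
  obtain ⟨eb, heb⟩ : ∃ ca, ca = rv f (x' + Pi.single b 1) - rv f x' := ⟨_, rfl⟩
  obtain ⟨e2, he2⟩ : ∃ c2, c2 = rv f (x' + Pi.single a 1 + Pi.single b 1)
    - rv f (x' + Pi.single a 1) - rv f (x' + Pi.single b 1) + rv f x' := ⟨_, rfl⟩
  have F1 : ∀ s t, rv f (x + Pi.single a s + Pi.single b t)
      = c0 + s * ca + t * cb + s * t * c2 := by
    intro s t; rw [hf.raff2, hc0, hca, hcb, hc2]
  have F2 : ∀ s t, rv f (x' + Pi.single a s + Pi.single b t)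
      = e0 + s * ea + t * eb + s * t * e2 := by
    intro s t; rw [hf.raff2, he0, hea, heb, he2]
  have sa : ∀ (w : κ → ℝ) (s t : ℝ), w + Pi.single a s + Pi.single b t + Pi.single a 1
      = w + Pi.single a (s + 1) + Pi.single b t := by
    intro w s t; rw [Pi.single_add]; abel
  have sb : ∀ (w : κ → ℝ) (s t : ℝ), w + Pi.single a s + Pi.single b t + Pi.single b 1
      = w + Pi.single a s + Pi.single b (t + 1) := by
    intro w s t; rw [Pi.single_add]; abel
  have sk : ∀ (s t : ℝ), x + Pi.single a s + Pi.single b t + Pi.single k 1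
      = x' + Pi.single a s + Pi.single b t := by
    intro s t; rw [hx']; abel
  rw [hyx] at pa pb ⊢
  simp only [sk, sa, sb, F1, F2] at pa pb ⊢
  have key := barrier_algebra c0 (ca + cb) c2 (e0 - c0) (ea + eb - (ca + cb)) (e2 - c2) h
    (by rw [hc0]; exact hx0) (by rw [hca, hcb]; linarith) (by rw [hc2]; exact qab) h0 h1 ?_ δ hδ
    (by rw [he0, hc0, hx']; exact hxk) (by linarith)
  · linarith
  · intro τ
    have ra := hf.rayleigh (x + Pi.single a τ + Pi.single b τ) a k hka
    have rb := hf.rayleigh (x + Pi.single a τ + Pi.single b τ) b k hkb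
    simp only [sk, sa, sb, F1, F2] at ra rb
    linarith

variable {ι : Type*} [DecidableEq ι]

/-- Iterated averaging over a list of indices. -/
def E : List ι → ((ι × Bool → ℂ) → ℂ) → ((ι × Bool → ℂ) → ℂ)
  | [], f => f
  | i :: l, f => E l (T (i, false) (i, true) (1 / 2) f)

lemma Good.E {d : ℕ} (l : List ι) {f : (ι × Bool → ℂ) → ℂ} (hf : Good d f) :
    Good d (E l f) := by
  induction l generalizing f with
  | nil => exact hf
  | cons i l ih => exact ih (hf.shift (by norm_num) (by norm_num))

lemma barrier {d : ℕ} (l : List ι) (hl : l.Nodup) {f : (ι × Bool → ℂ) → ℂ} (hf : Good d f)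
    {ζ : ι × Bool → ℝ} {h : ℝ} (h0 : 0 ≤ h) (h1 : h ≤ 1 / 2) (hI : Inv f ζ h {k | k.1 ∈ l})
    (y : ι × Bool → ℝ) (hy : ζ ≤ y) (hy' : ∀ k : ι × Bool, k.1 ∈ l → ζ k + (1 / 2 + h) ≤ y k) :
    0 < rv (E l f) y := by
  induction l generalizing f ζ with
  | nil => exact (hI y hy).1
  | cons i l ih =>
    obtain ⟨hi, hl'⟩ := List.nodup_cons.mp hl
    have hs := barrier_step hf hI h0 h1 (a := (i, false)) (b := (i, true)) (by simp) (by simp)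
    refine ih hl' (hf.shift (by norm_num) (by norm_num))
      (ζ := ζ + Pi.single (i, false) (1 / 2 + h) + Pi.single (i, true) (1 / 2 + h)) ?_ ?_ ?_
    · intro y hy
      refine ⟨(hs y hy).1, fun k hk => (hs y hy).2 k ?_⟩
      refine ⟨List.mem_cons_of_mem _ hk, ?_⟩
      rintro (rfl | rfl)
      · exact hi hk
      · exact hi hk
    · rintro ⟨j, c⟩
      by_cases hj : j = i
      · subst hj
        have := hy' (j, c) (by simp)
        cases c <;> simpa using this
      · have := hy (j, c)
        simpa [hj, Pi.single_apply] using this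
    · rintro ⟨j, c⟩ hk
      have hj : j ≠ i := by rintro rfl; exact hi hk
      have := hy' (j, c) (List.mem_cons_of_mem _ hk)
      simpa [hj, Pi.single_apply] using this

lemma Good.roots {d : ℕ} {f : (κ → ℂ) → ℂ} (hf : Good d f) :
    ∃ R : Multiset ℝ, R.card = d ∧ ∀ x : ℝ, rv f (fun _ => x) = (R.map (fun r => x - r)).prod := by
  obtain ⟨P, hP, dP, eP⟩ := hf.monic 0
  have hreal : ∀ ρ ∈ P.roots, ((ρ.re : ℝ) : ℂ) = ρ := by
    intro ρ hρ
    have h0 : P.eval ρ = 0 := (Polynomial.mem_roots'.mp hρ).2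
    rw [eP] at h0
    simp only [Pi.zero_apply, add_zero] at h0
    apply Complex.ext
    · simp
    · simp only [Complex.ofReal_im]
      by_contra hne
      rcases lt_or_gt_of_ne hne with h | h
      · exact hf.stable _ (fun _ => h) h0
      · have h2 := hf.real (fun _ => ρ)
        rw [h0, star_zero] at h2
        refine hf.stable _ (fun k => ?_) h2
        simpa using h
  have hs : P.Splits := IsAlgClosed.splits P
  refine ⟨P.roots.map Complex.re, ?_, ?_⟩
  · rw [Multiset.card_map, ← dP]
    exact hs.natDegree_eq_card_roots.symm
  · intro x
    have h1 := eP x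
    simp only [Pi.zero_apply, add_zero] at h1
    have h2 := hf.ofReal (fun _ => x)
    have h3 : P.eval (x : ℂ) = (P.roots.map (fun r => (x : ℂ) - r)).prod := by
      conv_lhs => rw [hs.eq_prod_roots_of_monic hP]
      rw [Polynomial.eval_multiset_prod, Multiset.map_map]
      congr 1
      apply Multiset.map_congr rfl
      intro r _
      simp
    have h4 : (((P.roots.map Complex.re).map (fun r => x - r)).prod : ℂ)
      = (P.roots.map (fun r => (x : ℂ) - r)).prod := by
      rw [Multiset.map_map]
      rw [← Complex.ofRealHom_eq_coe, map_multiset_prod, Multiset.map_map]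
      congr 1
      apply Multiset.map_congr rfl
      intro r hr
      simp [hreal r hr]
    have : (rv f (fun _ => x) : ℂ) = (((P.roots.map Complex.re).map (fun r => x - r)).prod : ℝ) := by
      rw [h4, ← h3, h1, h2]
    exact_mod_cast this

lemma prod_lower (R : Multiset ℝ) (c x : ℝ) (hx : c ≤ x) (h : ∀ r ∈ R, r < c) :
    (x - c) ^ R.card ≤ (R.map (fun r => x - r)).prod := by
  induction R using Multiset.induction_on with
  | empty => simp
  | cons r R ih =>
    have hr := h r (by simp)
    have := ih (fun s hs => h s (Multiset.mem_cons_of_mem hs))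
    rw [Multiset.map_cons, Multiset.prod_cons, Multiset.card_cons, pow_succ']
    exact mul_le_mul (by linarith) this (pow_nonneg (by linarith) _) (by linarith)

lemma roots_lower {d : ℕ} {p : ℝ → ℝ} (h : ∃ R : Multiset ℝ, R.card = d ∧
    ∀ x : ℝ, p x = (R.map (fun r => x - r)).prod) {c : ℝ} (hp : ∀ x, c ≤ x → 0 < p x) :
    ∀ x, c ≤ x → (x - c) ^ d ≤ p x := by
  obtain ⟨R, hR, e⟩ := h
  intro x hx
  rw [e, ← hR]
  apply prod_lower R c x hx
  intro r hr
  by_contra hc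
  push Not at hc
  have := hp r hc
  rw [e, Multiset.prod_eq_zero] at this
  · exact lt_irrefl _ this
  · rw [Multiset.mem_map]; exact ⟨r, hr, by simp⟩

lemma roots_bound {d : ℕ} {p : ℝ → ℝ} (h : ∃ R : Multiset ℝ, R.card = d ∧
    ∀ x : ℝ, p x = (R.map (fun r => x - r)).prod) : ∃ M, ∀ x, M < x → 0 < p x := by
  obtain ⟨R, hR, e⟩ := h
  obtain ⟨M, hM⟩ := R.toFinset.bddAbove
  refine ⟨M, fun x hx => ?_⟩
  rw [e]
  apply Multiset.prod_pos
  intro a ha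
  obtain ⟨r, hr, rfl⟩ := Multiset.mem_map.mp ha
  have := hM (by simpa using hr : r ∈ (R.toFinset : Set ℝ))
  linarith

/-- Homotopy step. -/
lemma homotopy {d : ℕ} {p0 p1 : ℝ → ℝ} (c0 : Continuous p0) (c1 : Continuous p1)
    (hR : ∀ t : ℝ, 0 ≤ t → t ≤ 1 → ∃ R : Multiset ℝ, R.card = d ∧
      ∀ x : ℝ, (1 - t) * p0 x + t * p1 x = (R.map (fun r => x - r)).prod)
    (c : ℝ) (hp : ∀ x, c ≤ x → 0 < p0 x) (h1 : 0 < p1 c) : ∀ x, c ≤ x → 0 < p1 x := by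
  obtain ⟨M0, hM0⟩ := roots_bound (hR 0 le_rfl zero_le_one)
  obtain ⟨M1, hM1⟩ := roots_bound (hR 1 zero_le_one le_rfl)
  simp only [sub_zero, one_mul, zero_mul, add_zero, sub_self, zero_add] at hM0 hM1
  set s : Set ℝ := {t | ∀ x, c ≤ x → (x - c) ^ d ≤ (1 - t) * p0 x + t * p1 x} with hs
  have hcl : IsClosed s := by
    have : s = ⋂ x, ⋂ (_ : c ≤ x), {t | (x - c) ^ d ≤ (1 - t) * p0 x + t * p1 x} := by
      ext t; simp [hs]
    rw [this]
    refine isClosed_iInter fun x => isClosed_iInter fun _ => ?_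
    exact isClosed_le (by fun_prop) (by fun_prop)
  have hpos : ∀ t ∈ s, 0 ≤ t → t ≤ 1 → ∀ x, c ≤ x → 0 < (1 - t) * p0 x + t * p1 x := by
    intro t ht t0 t1 x hx
    rcases hx.lt_or_eq with h | h
    · exact (pow_pos (by linarith) d).trans_le (ht x hx)
    · subst h
      have := hp c le_rfl
      rcases t0.lt_or_eq with h' | h'
      · have : 0 ≤ (1 - t) * p0 c := mul_nonneg (by linarith) this.le
        have : 0 < t * p1 c := mul_pos h' h1
        linarith
      · subst h'; simpa using this
  have hmem : ∀ t, 0 ≤ t → t ≤ 1 → (∀ x, c ≤ x → 0 < (1 - t) * p0 x + t * p1 x) → t ∈ s := by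
    intro t t0 t1 h
    exact roots_lower (hR t t0 t1) h
  have hsub : Set.Icc (0 : ℝ) 1 ⊆ s := by
    refine IsClosed.Icc_subset_of_forall_mem_nhdsWithin (hcl.inter isClosed_Icc) ?_ ?_
    · exact hmem 0 le_rfl zero_le_one (by simpa using hp)
    · rintro t ⟨ht, t0, t1⟩
      have hq := hpos t ht t0 t1.le
      have hev : ∀ᶠ t' in nhds t, ∀ x ∈ Set.Icc c (max M0 M1),
          0 < (1 - t') * p0 x + t' * p1 x := by
        apply isCompact_Icc.eventually_forall_of_forall_eventually
        intro x hx
        have hc : Continuous fun z : ℝ × ℝ => (1 - z.1) * p0 z.2 + z.1 * p1 z.2 := by fun_prop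
        exact hc.continuousAt.eventually (lt_mem_nhds (hq x hx.1))
      filter_upwards [nhdsWithin_le_nhds hev, Ioo_mem_nhdsGT t1] with t' h1' h2'
      apply hmem t' (by linarith [h2'.1]) h2'.2.le
      intro x hx
      by_cases hxM : x ≤ max M0 M1
      · exact h1' x ⟨hx, hxM⟩
      · push Not at hxM
        have q0 := hM0 x ((le_max_left _ _).trans_lt hxM)
        have q1 := hM1 x ((le_max_right _ _).trans_lt hxM)
        have t'0 : 0 < t' := by linarith [h2'.1]
        have : 0 < (1 - t') * p0 x := mul_pos (by linarith [h2'.2]) q0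
        have : 0 < t' * p1 x := mul_pos t'0 q1
        linarith
  intro x hx
  have := hpos 1 (hsub ⟨zero_le_one, le_rfl⟩) zero_le_one le_rfl x hx
  simpa using this

lemma interlace {d : ℕ} {p0 p1 : ℝ → ℝ} (c0 : Continuous p0) (c1 : Continuous p1)
    (hR : ∀ t : ℝ, 0 ≤ t → t ≤ 1 → ∃ R : Multiset ℝ, R.card = d ∧
      ∀ x : ℝ, (1 - t) * p0 x + t * p1 x = (R.map (fun r => x - r)).prod)
    (c : ℝ) (hp : ∀ x, c ≤ x → 0 < (1 - 1 / 2) * p0 x + 1 / 2 * p1 x) :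
    (∀ x, c ≤ x → 0 < p0 x) ∨ (∀ x, c ≤ x → 0 < p1 x) := by
  have hc := hp c le_rfl
  by_cases h0 : 0 < p0 c
  · left
    refine homotopy (d := d) (p0 := fun x => (1 - 1 / 2) * p0 x + 1 / 2 * p1 x) (p1 := p0)
      (by fun_prop) c0 ?_ c hp h0
    intro t t0 t1
    obtain ⟨R, hR1, hR2⟩ := hR ((1 - t) / 2) (by linarith) (by linarith)
    refine ⟨R, hR1, fun x => ?_⟩
    rw [← hR2]; ring
  · right
    refine homotopy (d := d) (p0 := fun x => (1 - 1 / 2) * p0 x + 1 / 2 * p1 x) (p1 := p1)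
      (by fun_prop) c1 ?_ c hp (by linarith)
    intro t t0 t1
    obtain ⟨R, hR1, hR2⟩ := hR ((1 + t) / 2) (by linarith) (by linarith)
    refine ⟨R, hR1, fun x => ?_⟩
    rw [← hR2]; ring

lemma E_linear (l : List ι) (f g : (ι × Bool → ℂ) → ℂ) (u v : ℂ) (z : ι × Bool → ℂ) :
    E l (fun z => u * f z + v * g z) z = u * E l f z + v * E l g z := by
  induction l generalizing f g with
  | nil => rfl
  | cons i l ih =>
    simp only [E]
    rw [← ih]
    congr 1
    ext w
    simp only [T]
    ring

lemma E_T (l : List ι) (f : (ι × Bool → ℂ) → ℂ) (a b : ι × Bool) (s : ℝ) (y : ι × Bool → ℝ) :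
    rv (E l (T a b s f)) y =
      (1 - s) * rv (E l (fun z => f (z - Pi.single a 1))) y
        + s * rv (E l (fun z => f (z - Pi.single b 1))) y := by
  unfold rv
  have : T a b s f = fun z => ((1 - s : ℝ) : ℂ) * (fun z => f (z - Pi.single a 1)) z
    + ((s : ℝ) : ℂ) * (fun z => f (z - Pi.single b 1)) z := rfl
  rw [this, E_linear, Complex.add_re, Complex.re_ofReal_mul, Complex.re_ofReal_mul]

lemma T_zero (a b : κ) (f : (κ → ℂ) → ℂ) : T a b 0 f = fun z => f (z - Pi.single a 1) := by
  ext z; simp [T]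

lemma T_one (a b : κ) (f : (κ → ℂ) → ℂ) : T a b 1 f = fun z => f (z - Pi.single b 1) := by
  ext z; simp [T]

lemma Good.cont_diag {d : ℕ} {f : (κ → ℂ) → ℂ} (hf : Good d f) :
    Continuous fun x : ℝ => rv f (fun _ => x) := by
  unfold rv
  have := hf.cont
  fun_prop

/-- Rounding. -/
lemma rounding {d : ℕ} (l : List ι) (hl : l.Nodup) {f : (ι × Bool → ℂ) → ℂ} (hf : Good d f) (c : ℝ)
    (hp : ∀ x : ℝ, c ≤ x → 0 < rv (E l f) (fun _ => x)) :
    ∃ σ : ι → Bool, ∀ x : ℝ, c ≤ x →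
      0 < (f (fun k => (x : ℂ) - if k.1 ∈ l ∧ σ k.1 = k.2 then 1 else 0)).re := by
  induction l generalizing f with
  | nil =>
    refine ⟨fun _ => true, fun x hx => ?_⟩
    simpa [E, rv] using hp x hx
  | cons i l ih =>
    obtain ⟨hi, hl'⟩ := List.nodup_cons.mp hl
    have g0 : Good d (fun z => f (z - Pi.single (i, false) 1)) := by
      rw [← T_zero _ (i, true)]; exact hf.shift le_rfl zero_le_one
    have g1 : Good d (fun z => f (z - Pi.single (i, true) 1)) := by
      rw [← T_one (i, false)]; exact hf.shift zero_le_one le_rfl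
    have fin : ∀ b : Bool, (∀ x : ℝ, c ≤ x →
        0 < rv (E l (fun z => f (z - Pi.single (i, b) 1))) (fun _ => x)) →
        Good d (fun z => f (z - Pi.single (i, b) 1)) → ∃ σ : ι → Bool, ∀ x : ℝ, c ≤ x →
      0 < (f (fun k => (x : ℂ) - if k.1 ∈ i :: l ∧ σ k.1 = k.2 then 1 else 0)).re := by
      intro b hb hg
      obtain ⟨σ, hσ⟩ := ih hl' hg hb
      refine ⟨Function.update σ i b, fun x hx => ?_⟩
      have := hσ x hx
      convert this using 3
      ext ⟨j, e⟩
      by_cases hj : j = i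
      · subst hj
        by_cases hbe : b = e
        · subst hbe; simp [hi]
        · have : e ≠ b := fun h => hbe h.symm
          simp [hi, hbe, this]
      · simp [hj]
    have key := interlace (d := d)
      (p0 := fun x => rv (E l (fun z => f (z - Pi.single (i, false) 1))) (fun _ => x))
      (p1 := fun x => rv (E l (fun z => f (z - Pi.single (i, true) 1))) (fun _ => x))
      (g0.E l).cont_diag (g1.E l).cont_diag ?_ c ?_
    · rcases key with h | h
      · exact fin false h g0
      · exact fin true h g1
    · intro t t0 t1
      have hg : Good d (T (i, false) (i, true) t f) := hf.shift t0 t1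
      obtain ⟨R, hR1, hR2⟩ := (hg.E l).roots
      refine ⟨R, hR1, fun x => ?_⟩
      rw [← hR2, E_T]
    · intro x hx
      have := hp x hx
      simp only [E] at this
      rwa [E_T] at this

end MSS

namespace MSS

open Matrix

lemma det_affine {p : ℕ} (M : Matrix (Fin p) (Fin p) ℂ) (u w : Fin p → ℂ) (t : ℂ) :
    (M + t • vecMulVec u w).det = M.det + t * ((M + vecMulVec u w).det - M.det) := by
  have key : ∃ a b : ℂ, ∀ t : ℂ, (M + t • vecMulVec u w).det = a + t * b := by
    let N : Matrix (Fin p ⊕ Unit) (Fin p ⊕ Unit) ℂ := fromBlocks M 0 (replicateRow Unit w) 1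
    refine ⟨(N.updateCol (Sum.inr ()) (Sum.elim 0 1)).det,
      (N.updateCol (Sum.inr ()) (Sum.elim (-u) 0)).det, fun t => ?_⟩
    rw [← det_updateCol_smul, ← det_updateCol_add]
    have e : N.updateCol (Sum.inr ()) ((Sum.elim 0 1 : Fin p ⊕ Unit → ℂ) + t • (Sum.elim (-u) 0 : Fin p ⊕ Unit → ℂ))
        = fromBlocks M (replicateCol Unit (-(t • u))) (replicateRow Unit w) 1 := by
      ext i j
      rcases i with i | i <;> rcases j with j | j <;> simp [N]
    rw [e, det_fromBlocks_one₂₂]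
    congr 1
    ext i j
    simp [vecMulVec_apply, mul_apply, mul_assoc]
  obtain ⟨a, b, h⟩ := key
  have h0 := h 0
  have h1 := h 1
  have ht := h t
  simp only [zero_smul, add_zero, zero_mul, one_smul, one_mul] at h0 h1
  rw [ht, h0, h1]; ring

set_option linter.unusedSectionVars false

variable {ι : Type*} [Fintype ι] [DecidableEq ι] {p : ℕ}

/-- The pencil. -/
def pen (v : ι → Fin p → ℂ) (z : ι → ℂ) : Matrix (Fin p) (Fin p) ℂ :=
  ∑ i, z i • rankOneMatrix (v i)

lemma pen_add_single (v : ι → Fin p → ℂ) (z : ι → ℂ) (i : ι) (t : ℂ) :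
    pen v (z + Pi.single i t) = pen v z + t • rankOneMatrix (v i) := by
  simp only [pen, Pi.add_apply, add_smul, Finset.sum_add_distrib]
  congr 1
  rw [Finset.sum_eq_single i]
  · simp
  · intro j _ hj; simp [hj]
  · simp

lemma rankOne_herm (w : Fin p → ℂ) : (rankOneMatrix w)ᴴ = rankOneMatrix w := by
  unfold rankOneMatrix
  rw [conjTranspose_vecMulVec, star_star]

lemma rankOne_psd (w : Fin p → ℂ) : (rankOneMatrix w).PosSemidef :=
  posSemidef_vecMulVec_self_star w

lemma pen_star (v : ι → Fin p → ℂ) (z : ι → ℂ) : pen v (star z) = (pen v z)ᴴ := by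
  simp [pen, conjTranspose_sum, conjTranspose_smul, rankOne_herm]

lemma pen_const (v : ι → Fin p → ℂ) (hv : ∑ i, rankOneMatrix (v i) = 1) (x : ℂ) (w : ι → ℂ) :
    pen v (fun i => x + w i) = x • 1 + pen v w := by
  simp only [pen, add_smul, Finset.sum_add_distrib, ← Finset.smul_sum, hv]

lemma qf_rankOne (w x : Fin p → ℂ) :
    star x ⬝ᵥ (rankOneMatrix w *ᵥ x) = (Complex.normSq (star w ⬝ᵥ x) : ℂ) := by
  unfold rankOneMatrix
  rw [vecMulVec_mulVec]
  rw [← Complex.mul_conj]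
  have : conj (star w ⬝ᵥ x) = star x ⬝ᵥ w := by
    rw [starRingEnd_apply, star_dotProduct x w]
  rw [this]
  simp [dotProduct_smul]


lemma qf_pen (v : ι → Fin p → ℂ) (z : ι → ℂ) (x : Fin p → ℂ) :
    star x ⬝ᵥ (pen v z *ᵥ x) = ∑ i, z i * (Complex.normSq (star (v i) ⬝ᵥ x) : ℂ) := by
  unfold pen
  rw [sum_mulVec, dotProduct_sum]
  refine Finset.sum_congr rfl fun i _ => ?_
  rw [smul_mulVec, dotProduct_smul, qf_rankOne, smul_eq_mul]

lemma pen_stable (v : ι → Fin p → ℂ) (hv : ∑ i, rankOneMatrix (v i) = 1) (z : ι → ℂ)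
    (hz : ∀ i, 0 < (z i).im) : (pen v z).det ≠ 0 := by
  intro h
  obtain ⟨x, hx, hM⟩ := exists_mulVec_eq_zero_iff.mpr h
  have h1 := qf_pen v z x
  rw [hM, dotProduct_zero] at h1
  have h2 := congrArg Complex.im h1
  simp only [Complex.zero_im, Complex.im_sum, Complex.im_mul_ofReal] at h2
  have h3 := (Finset.sum_eq_zero_iff_of_nonneg (fun i _ =>
    mul_nonneg (hz i).le (Complex.normSq_nonneg _))).mp h2.symm
  apply hx
  have h4 : (∑ i, rankOneMatrix (v i)) *ᵥ x = 0 := by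
    rw [sum_mulVec]
    refine Finset.sum_eq_zero fun i hi => ?_
    have := (mul_eq_zero.mp (h3 i hi)).resolve_left (hz i).ne'
    rw [Complex.normSq_eq_zero] at this
    unfold rankOneMatrix
    rw [vecMulVec_mulVec, this]
    simp
  rwa [hv, one_mulVec] at h4

/-- The base polynomial. -/
def F (v : ι → Fin p → ℂ) (z : ι × Bool → ℂ) : ℂ :=
  (pen v (fun i => z (i, false))).det * (pen v (fun i => z (i, true))).det

lemma pen_det_monic (v : ι → Fin p → ℂ) (hv : ∑ i, rankOneMatrix (v i) = 1) (w : ι → ℂ) :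
    ∃ P : Polynomial ℂ, P.Monic ∧ P.natDegree = p ∧
      ∀ x : ℂ, P.eval x = (pen v (fun i => x + w i)).det := by
  refine ⟨(-(pen v w)).charpoly, charpoly_monic _, by simp, fun x => ?_⟩
  rw [eval_charpoly, pen_const v hv, sub_neg_eq_add]
  congr 2
  ext i j
  by_cases h : i = j
  · subst h; simp
  · simp [h]

lemma restrict_same (z : ι × Bool → ℂ) (i : ι) (b : Bool) (t : ℂ) :
    (fun j => (z + Pi.single (i, b) t : ι × Bool → ℂ) (j, b))
      = (fun j => z (j, b)) + Pi.single i t := by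
  ext j
  by_cases h : j = i
  · subst h; simp
  · simp [h]

lemma restrict_diff (z : ι × Bool → ℂ) (i : ι) (b c : Bool) (hbc : c ≠ b) (t : ℂ) :
    (fun j => (z + Pi.single (i, b) t : ι × Bool → ℂ) (j, c)) = (fun j => z (j, c)) := by
  ext j
  simp [hbc]

lemma good_F (v : ι → Fin p → ℂ) (hv : ∑ i, rankOneMatrix (v i) = 1) : Good (p + p) (F v) where
  cont := by
    unfold F
    have hc : ∀ b : Bool, Continuous fun z : ι × Bool → ℂ => pen v (fun i => z (i, b)) := by
      intro b
      unfold pen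
      fun_prop
    exact (hc false).matrix_det.mul (hc true).matrix_det
  aff := by
    rintro z ⟨i, b⟩ t
    unfold F
    cases b
    · rw [restrict_same, restrict_same, restrict_diff _ _ _ _ (by simp),
        restrict_diff _ _ _ _ (by simp), pen_add_single, pen_add_single, rankOneMatrix, one_smul,
        det_affine]
      ring
    · rw [restrict_same, restrict_same, restrict_diff _ _ _ _ (by simp),
        restrict_diff _ _ _ _ (by simp), pen_add_single, pen_add_single, rankOneMatrix, one_smul,
        det_affine]
      ring
  real := by
    intro z
    unfold F
    have h : ∀ b : Bool, (pen v (fun i => (star z) (i, b))).det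
        = star (pen v (fun i => z (i, b))).det := by
      intro b
      rw [← det_conjTranspose, ← pen_star]
      rfl
    rw [h, h, star_mul, mul_comm]
  stable := by
    intro z hz
    unfold F
    exact mul_ne_zero (pen_stable v hv _ fun i => hz _) (pen_stable v hv _ fun i => hz _)
  monic := by
    intro w
    obtain ⟨P, hP, dP, eP⟩ := pen_det_monic v hv (fun i => w (i, false))
    obtain ⟨Q, hQ, dQ, eQ⟩ := pen_det_monic v hv (fun i => w (i, true))
    refine ⟨P * Q, hP.mul hQ, ?_, ?_⟩
    · rw [hP.natDegree_mul hQ, dP, dQ]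
    · intro x
      rw [Polynomial.eval_mul, eP, eQ, F]

lemma pen_real_ge (v : ι → Fin p → ℂ) (hv : ∑ i, rankOneMatrix (v i) = 1) (y : ι → ℝ) (t : ℝ)
    (hy : ∀ i, t ≤ y i) : (pen v (fun i => (y i : ℂ)) - (t : ℂ) • 1).PosSemidef := by
  have e : pen v (fun i => (y i : ℂ)) - (t : ℂ) • 1
      = ∑ i, ((y i - t : ℝ) : ℂ) • rankOneMatrix (v i) := by
    rw [← hv, Finset.smul_sum, pen, ← Finset.sum_sub_distrib]
    refine Finset.sum_congr rfl fun i _ => ?_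
    rw [← sub_smul]; push_cast; rfl
  rw [e]
  refine posSemidef_sum _ fun i _ => (rankOne_psd (v i)).smul ?_
  have := hy i
  exact_mod_cast (by linarith : (0 : ℝ) ≤ y i - t)

lemma posDef_of_ge (M : Matrix (Fin p) (Fin p) ℂ) (t : ℝ) (ht : 0 < t)
    (hM : (M - (t : ℂ) • 1).PosSemidef) : M.PosDef := by
  have : M = (t : ℂ) • 1 + (M - (t : ℂ) • 1) := by abel
  rw [this]
  refine PosDef.add_posSemidef (PosDef.one.smul ?_) hM
  exact_mod_cast ht

lemma star_dot_self (w : Fin p → ℂ) : star w ⬝ᵥ w = ((∑ k, ‖w k‖ ^ 2 : ℝ) : ℂ) := by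
  simp only [dotProduct, Pi.star_apply]
  push_cast
  refine Finset.sum_congr rfl fun i _ => ?_
  rw [RCLike.star_def, Complex.conj_mul']

lemma inv_qf (M : Matrix (Fin p) (Fin p) ℂ) (t : ℝ) (ht : 0 < t)
    (hM : (M - (t : ℂ) • 1).PosSemidef) (w : Fin p → ℂ) :
    ∃ r : ℝ, star w ⬝ᵥ (M⁻¹ *ᵥ w) = (r : ℂ) ∧ 0 ≤ r ∧ t * r ≤ ∑ k, ‖w k‖ ^ 2 := by
  have hP := posDef_of_ge M t ht hM
  have hr := hP.inv.posSemidef.dotProduct_mulVec_nonneg w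
  obtain ⟨r, hr0, hr1⟩ := Complex.nonneg_iff.mp hr |>.imp (fun h => h) (fun h => h) |> fun h =>
    (⟨(star w ⬝ᵥ (M⁻¹ *ᵥ w)).re, h.1, Complex.ext rfl (by simpa using h.2.symm)⟩ :
      ∃ r : ℝ, 0 ≤ r ∧ star w ⬝ᵥ (M⁻¹ *ᵥ w) = (r : ℂ))
  refine ⟨r, hr1, hr0, ?_⟩
  obtain ⟨u, hu⟩ : ∃ u, u = M⁻¹ *ᵥ w := ⟨_, rfl⟩
  have hMu : M *ᵥ u = w := by
    rw [hu, mulVec_mulVec, mul_nonsing_inv _ ((isUnit_iff_isUnit_det M).mp hP.isUnit), one_mulVec]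
  rw [← hu] at hr1
  have hr2 : star u ⬝ᵥ w = (r : ℂ) := by
    rw [star_dotProduct, hr1]; simp
  have h1 := hM.dotProduct_mulVec_nonneg u
  rw [sub_mulVec, hMu, smul_mulVec, one_mulVec, dotProduct_sub, dotProduct_smul, hr2,
    star_dot_self, smul_eq_mul] at h1
  have h1' : t * (∑ k, ‖u k‖ ^ 2) ≤ r := by
    have : (0 : ℂ) ≤ ((r - t * (∑ k, ‖u k‖ ^ 2) : ℝ) : ℂ) := by push_cast; push_cast at h1; exact h1
    have := Complex.zero_le_real.mp this
    linarith
  have h2 : (0 : ℂ) ≤ star (w - (t : ℂ) • u) ⬝ᵥ (w - (t : ℂ) • u) := dotProduct_star_self_nonneg _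
  have h3 : star (w - (t : ℂ) • u) ⬝ᵥ (w - (t : ℂ) • u)
      = ((∑ k, ‖w k‖ ^ 2 - 2 * t * r + t ^ 2 * ∑ k, ‖u k‖ ^ 2 : ℝ) : ℂ) := by
    rw [star_sub, star_smul, sub_dotProduct, dotProduct_sub, dotProduct_sub, smul_dotProduct,
      smul_dotProduct, dotProduct_smul, dotProduct_smul, hr1, hr2, star_dot_self, star_dot_self]
    simp only [smul_eq_mul, RCLike.star_def, Complex.conj_ofReal]
    push_cast; ring
  rw [h3] at h2
  have h4 := Complex.zero_le_real.mp h2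
  nlinarith

lemma det_update (M : Matrix (Fin p) (Fin p) ℂ) (hM : IsUnit M.det) (w : Fin p → ℂ) :
    (M + rankOneMatrix w).det = M.det * (1 + star w ⬝ᵥ (M⁻¹ *ᵥ w)) := by
  have e : rankOneMatrix w = replicateCol Unit w * replicateRow Unit (star w) := by
    ext i j; simp [rankOneMatrix, vecMulVec_apply, mul_apply]
  rw [e, det_add_replicateCol_mul_replicateRow hM]
  congr 1
  rw [det_unique, Matrix.add_apply, Matrix.one_apply_eq]
  congr 1
  rw [Matrix.mul_assoc, ← replicateCol_mulVec]
  simp [mul_apply, dotProduct]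

lemma inv_F (v : ι → Fin p → ℂ) (hv : ∑ i, rankOneMatrix (v i) = 1) (h : ℝ) (h0 : 0 < h)
    (hn : ∀ i, ∑ k, ‖v i k‖ ^ 2 ≤ h ^ 2) (K : Set (ι × Bool)) : Inv (F v) (fun _ => h) h K := by
  intro y hy
  have G : ∀ b : Bool, ∃ r : ℝ, (pen v (fun i => (y (i, b) : ℂ))).det = (r : ℂ) ∧ 0 < r ∧
      ∀ i, ∃ s : ℝ, (pen v ((fun i => (y (i, b) : ℂ)) + Pi.single i 1)).det = (s : ℂ) ∧
        s ≤ (1 + h) * r := by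
    intro b
    have hge := pen_real_ge v hv (fun i => y (i, b)) h (fun i => hy (i, b))
    have hPD := posDef_of_ge _ h h0 hge
    have hd := hPD.det_pos
    obtain ⟨hd1, hd2⟩ := Complex.pos_iff.mp hd
    obtain ⟨r, hr⟩ : ∃ r : ℝ, r = (pen v (fun i => (y (i, b) : ℂ))).det.re := ⟨_, rfl⟩
    have er : (pen v (fun i => (y (i, b) : ℂ))).det = (r : ℂ) :=
      Complex.ext (by simp [hr]) (by simpa using hd2.symm)
    have r0 : 0 < r := by rw [hr]; exact hd1
    refine ⟨r, er, r0, fun i => ?_⟩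
    obtain ⟨s, hs, s0, hs1⟩ := inv_qf _ h h0 hge (v i)
    refine ⟨r * (1 + s), ?_, ?_⟩
    · rw [pen_add_single, one_smul, det_update _ ((isUnit_iff_isUnit_det _).mp hPD.isUnit), er, hs]
      push_cast; rfl
    · have : s ≤ h := by
        have := hn i
        by_contra hc
        push Not at hc
        nlinarith
      nlinarith
  obtain ⟨r0, e0, p0, q0⟩ := G false
  obtain ⟨r1, e1, p1, q1⟩ := G true
  have eF : rv (F v) y = r0 * r1 := by
    unfold rv F
    rw [e0, e1, ← Complex.ofReal_mul, Complex.ofReal_re]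
  refine ⟨by rw [eF]; positivity, ?_⟩
  rintro ⟨i, b⟩ _
  have ec := cast_add_single y (i, b) 1
  rw [Complex.ofReal_one] at ec
  have eF' : rv (F v) (y + Pi.single (i, b) 1)
      = (F v ((fun j => (y j : ℂ)) + Pi.single (i, b) 1)).re := by
    unfold rv
    rw [ec]
  rw [eF', eF]
  unfold F
  cases b
  · obtain ⟨s, hs, hs1⟩ := q0 i
    rw [restrict_same, restrict_diff _ _ _ _ (by simp), hs, e1, ← Complex.ofReal_mul,
      Complex.ofReal_re]
    nlinarith
  · obtain ⟨s, hs, hs1⟩ := q1 i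
    rw [restrict_same, restrict_diff _ _ _ _ (by simp), hs, e0, ← Complex.ofReal_mul,
      Complex.ofReal_re]
    nlinarith

lemma psd_of_det (M : Matrix (Fin p) (Fin p) ℂ) (hM : M.IsHermitian) (c : ℝ)
    (h : ∀ x : ℝ, c ≤ x → ((x : ℂ) • 1 - M).det ≠ 0) : ((c : ℂ) • 1 - M).PosSemidef := by
  have hH : ((c : ℂ) • 1 - M).IsHermitian := by
    unfold IsHermitian
    rw [conjTranspose_sub, hM, conjTranspose_smul, conjTranspose_one]
    simp
  rw [hH.posSemidef_iff_eigenvalues_nonneg]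
  intro i
  by_contra hc
  simp only [Pi.zero_apply, not_le] at hc
  set lam := hH.eigenvalues i with hlam
  refine h (c - lam) (by linarith) ?_
  rw [← exists_mulVec_eq_zero_iff]
  have hm := hH.mulVec_eigenvectorBasis i
  refine ⟨(hH.eigenvectorBasis i).ofLp, ?_, ?_⟩
  · intro h0
    have h1 := hH.eigenvectorBasis.orthonormal.ne_zero i
    apply h1
    ext k
    exact congrFun h0 k
  · have e : (((c - lam : ℝ) : ℂ) • 1 - M) = ((c : ℂ) • 1 - M) - (lam : ℂ) • 1 := by
      push_cast; rw [sub_smul]; abel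
    rw [e, sub_mulVec, hm, smul_mulVec, one_mulVec, ← hlam]
    ext k
    simp

/-- The Marcus–Spielman–Srivastava theorem for two parts. -/
theorem split_one (v : ι → Fin p → ℂ) (hv : ∑ i, rankOneMatrix (v i) = 1) (h : ℝ) (h0 : 0 < h)
    (h1 : h ≤ 1 / 2) (hn : ∀ i, ∑ k, ‖v i k‖ ^ 2 ≤ h ^ 2) :
    ∃ σ : ι → Bool, ∀ b : Bool, (((1 / 2 + 2 * h : ℝ) : ℂ) • 1
      - ∑ i with σ i = b, rankOneMatrix (v i)).PosSemidef := by
  have hg := good_F v hv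
  have hbar := barrier (Finset.univ.toList : List ι) (Finset.nodup_toList _) hg h0.le h1
    (inv_F v hv h h0 hn _)
  obtain ⟨σ, hσ⟩ := rounding (Finset.univ.toList : List ι) (Finset.nodup_toList _) hg
    (1 / 2 + 2 * h) (by
      intro x hx
      apply hbar
      · intro k; simp only; linarith
      · intro k _; linarith)
  refine ⟨σ, fun b => ?_⟩
  have hherm : (∑ i with σ i = b, rankOneMatrix (v i)).IsHermitian := by
    unfold IsHermitian
    rw [conjTranspose_sum]
    exact Finset.sum_congr rfl fun i _ => rankOne_herm _
  refine psd_of_det _ hherm _ fun x hx hdet => ?_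
  have := hσ x hx
  have e : ∀ b : Bool, pen v (fun i => (x : ℂ) - if σ i = b then 1 else 0)
      = (x : ℂ) • 1 - ∑ i with σ i = b, rankOneMatrix (v i) := by
    intro b
    rw [← hv, Finset.smul_sum, Finset.sum_filter, pen, ← Finset.sum_sub_distrib]
    refine Finset.sum_congr rfl fun i _ => ?_
    rw [sub_smul]
    split_ifs <;> simp
  simp only [F, Finset.mem_toList, Finset.mem_univ, true_and] at this
  rw [e, e] at this
  cases b
  · rw [hdet] at this; simp at this
  · rw [hdet] at this; simp at this

end MSS

namespace MSS

open Matrix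

section factor
open scoped MatrixOrder

lemma factor {p : ℕ} (M : Matrix (Fin p) (Fin p) ℂ) (hM : M.PosDef) :
    ∃ B : Matrix (Fin p) (Fin p) ℂ, M = Bᴴ * B := by
  obtain ⟨B, hB⟩ := CStarAlgebra.nonneg_iff_eq_star_mul_self.mp hM.posSemidef.nonneg
  exact ⟨B, hB⟩

end factor

lemma rankOne_mulVec {p : ℕ} (C : Matrix (Fin p) (Fin p) ℂ) (w : Fin p → ℂ) :
    rankOneMatrix (C *ᵥ w) = C * rankOneMatrix w * Cᴴ := by
  rw [rankOneMatrix, rankOneMatrix, star_mulVec, mul_vecMulVec, vecMulVec_mul]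

lemma split_gen {ι : Type*} [Fintype ι] [DecidableEq ι] {p : ℕ} (z : ι → Fin p → ℂ)
    (α δ : ℝ) (hα : 0 < α) (hδ : 0 < δ) (h4 : 4 * δ ≤ α)
    (hz : ∀ i, ∑ k, ‖z i k‖ ^ 2 ≤ δ)
    (hlow : ((∑ i, rankOneMatrix (z i)) - (α : ℂ) • 1).PosSemidef) :
    ∃ σ : ι → Bool, ∀ b, (((1 / 2 + 2 * √(δ / α) : ℝ) : ℂ) • (∑ i, rankOneMatrix (z i))
      - ∑ i with σ i = b, rankOneMatrix (z i)).PosSemidef := by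
  have hPD := posDef_of_ge _ α hα hlow
  obtain ⟨B, hB⟩ := factor _ hPD
  have hdet : IsUnit (Bᴴ * B).det := by
    rw [← hB]; exact (isUnit_iff_isUnit_det _).mp hPD.isUnit
  rw [det_mul, IsUnit.mul_iff] at hdet
  obtain ⟨hd1, hd2⟩ := hdet
  have hC1 : Bᴴ * (Bᴴ)⁻¹ = 1 := mul_nonsing_inv _ hd1
  have hC2 : (Bᴴ)⁻¹ * Bᴴ = 1 := nonsing_inv_mul _ hd1
  have hC3 : B * B⁻¹ = 1 := mul_nonsing_inv _ hd2
  have hC4 : B⁻¹ * B = 1 := nonsing_inv_mul _ hd2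
  have hCH : ((Bᴴ)⁻¹)ᴴ = B⁻¹ := by rw [conjTranspose_nonsing_inv, conjTranspose_conjTranspose]
  have hr : √(δ / α) ^ 2 = δ / α := Real.sq_sqrt (by positivity)
  obtain ⟨σ, hσ⟩ := split_one (fun i => (Bᴴ)⁻¹ *ᵥ z i) (by
      simp only [rankOne_mulVec, hCH]
      rw [← Finset.sum_mul, ← Finset.mul_sum, hB, ← Matrix.mul_assoc, hC2, Matrix.one_mul, hC3])
    (√(δ / α)) (by positivity) (by
      rw [Real.sqrt_le_left (by norm_num), div_le_iff₀ hα]; linarith) (by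
      intro i
      obtain ⟨r, e, hr0, hr1⟩ := inv_qf _ α hα hlow (z i)
      rw [hr, le_div_iff₀ hα]
      have : ∑ k, ‖((Bᴴ)⁻¹ *ᵥ z i) k‖ ^ 2 = r := by
        have h1 := star_dot_self ((Bᴴ)⁻¹ *ᵥ z i)
        rw [hB, Matrix.mul_inv_rev] at e
        rw [star_mulVec, hCH, ← dotProduct_mulVec, mulVec_mulVec, e] at h1
        exact_mod_cast h1.symm
      rw [this, mul_comm]
      exact hr1.trans (hz i))
  refine ⟨σ, fun b => ?_⟩
  have := (hσ b).conjTranspose_mul_mul_same B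
  convert this using 1
  simp only [rankOne_mulVec, hCH]
  rw [← Finset.sum_mul, ← Finset.mul_sum, Matrix.mul_sub, Matrix.sub_mul, hB]
  congr 1
  · simp
  · rw [Matrix.mul_assoc, Matrix.mul_assoc _ _ B, hC4, ← Matrix.mul_assoc, ← Matrix.mul_assoc, hC1]
    simp

/-- A version with two-sided bounds on a finite subset. -/
lemma split_two {q p : ℕ} (z : Fin q → Fin p → ℂ) (J : Finset (Fin q))
    (α β δ : ℝ) (hα : 0 < α) (hδ : 0 < δ) (h16 : 16 * δ ≤ α)
    (hz : ∀ i, ∑ k, ‖z i k‖ ^ 2 ≤ δ)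
    (hlow : ((∑ i ∈ J, rankOneMatrix (z i)) - (α : ℂ) • 1).PosSemidef)
    (hup : ((β : ℂ) • 1 - ∑ i ∈ J, rankOneMatrix (z i)).PosSemidef) :
    ∃ σ : Fin q → Bool, ∀ b,
      ((∑ i ∈ J with σ i = b, rankOneMatrix (z i))
        - ((α * (1 / 2 - 2 * √(δ / α)) : ℝ) : ℂ) • 1).PosSemidef ∧
      (((β * (1 / 2 + 2 * √(δ / α)) : ℝ) : ℂ) • 1
        - ∑ i ∈ J with σ i = b, rankOneMatrix (z i)).PosSemidef := by
  have e0 : ∑ i : J, rankOneMatrix (z i) = ∑ i ∈ J, rankOneMatrix (z i) :=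
    Finset.sum_coe_sort J (fun i => rankOneMatrix (z i))
  obtain ⟨σ, hσ⟩ := split_gen (fun i : J => z i) α δ hα hδ (by linarith) (fun i => hz i)
    (by rw [e0]; exact hlow)
  rw [e0] at hσ
  classical
  let τ : Fin q → Bool := fun i => if h : i ∈ J then σ ⟨i, h⟩ else false
  have e1 : ∀ b, ∑ i : J with σ i = b, rankOneMatrix (z i)
      = ∑ i ∈ J with τ i = b, rankOneMatrix (z i) := by
    intro b
    rw [Finset.sum_filter, Finset.sum_filter, ← Finset.sum_coe_sort J]
    refine Finset.sum_congr rfl fun i _ => ?_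
    simp [τ]
  simp only [e1] at hσ
  obtain ⟨c, hc⟩ : ∃ c, c = √(δ / α) := ⟨_, rfl⟩
  have hc0 : 0 ≤ c := by rw [hc]; positivity
  have hc1 : c ≤ 1 / 4 := by
    rw [hc, Real.sqrt_le_left (by norm_num), div_le_iff₀ hα]; linarith
  rw [← hc] at hσ ⊢
  have hsum : ∀ b, ∑ i ∈ J with τ i = b, rankOneMatrix (z i) =
      ∑ i ∈ J, rankOneMatrix (z i) - ∑ i ∈ J with τ i = !b, rankOneMatrix (z i) := by
    intro b
    rw [eq_sub_iff_add_eq, ← Finset.sum_filter_add_sum_filter_not J (fun i => τ i = b)]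
    congr 2
    ext i
    simp only [Finset.mem_filter]
    cases τ i <;> cases b <;> simp
  refine ⟨τ, fun b => ⟨?_, ?_⟩⟩
  · have h1 := hσ (!b)
    have h2 := hlow.smul (show (0 : ℂ) ≤ ((1 / 2 - 2 * c : ℝ) : ℂ) by
      exact_mod_cast (by linarith : (0 : ℝ) ≤ 1 / 2 - 2 * c))
    convert h1.add h2 using 1
    rw [hsum b]
    push_cast
    module
  · have h1 := hσ b
    have h2 := hup.smul (show (0 : ℂ) ≤ ((1 / 2 + 2 * c : ℝ) : ℂ) by
      exact_mod_cast (by linarith : (0 : ℝ) ≤ 1 / 2 + 2 * c))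
    convert h1.add h2 using 1
    push_cast
    module

lemma psd_upper_mono {p : ℕ} (A : Matrix (Fin p) (Fin p) ℂ) (c d : ℝ) (h : c ≤ d)
    (hA : ((c : ℂ) • 1 - A).PosSemidef) : ((d : ℂ) • 1 - A).PosSemidef := by
  have h2 := (PosSemidef.one (n := Fin p) (R := ℂ)).smul (show (0 : ℂ) ≤ ((d - c : ℝ) : ℂ) by
      exact_mod_cast sub_nonneg.2 h)
  convert hA.add h2 using 1
  push_cast
  module

lemma psd_lower_mono {p : ℕ} (A : Matrix (Fin p) (Fin p) ℂ) (c d : ℝ) (h : d ≤ c)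
    (hA : (A - (c : ℂ) • 1).PosSemidef) : (A - (d : ℂ) • 1).PosSemidef := by
  have h2 := (PosSemidef.one (n := Fin p) (R := ℂ)).smul (show (0 : ℂ) ≤ ((c - d : ℝ) : ℂ) by
      exact_mod_cast sub_nonneg.2 h)
  convert hA.add h2 using 1
  push_cast
  module

/-- The running constant. -/
def KK (δ α : ℝ) : ℝ := 3600 * Real.exp (-(25 * √(δ / α)))

lemma KK_step (δ α r : ℝ) (hδ : 0 < δ) (hα : 100 * δ < α) (hr : r = √(δ / α)) :
    KK δ (α * (1 / 2 - 2 * r)) * (1 / 2 + 2 * r) ≤ KK δ α * (1 / 2 - 2 * r) := by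
  have hα0 : 0 < α := by linarith
  have hr0 : 0 < r := by rw [hr]; positivity
  have hr1 : r ≤ 1 / 10 := by
    rw [hr, Real.sqrt_le_left (by norm_num), div_le_iff₀ hα0]; linarith
  have hrs : r ^ 2 = δ / α := by rw [hr]; exact Real.sq_sqrt (by positivity)
  obtain ⟨s, hs⟩ : ∃ s, s = √(δ / (α * (1 / 2 - 2 * r))) := ⟨_, rfl⟩
  have hp : 0 < 1 / 2 - 2 * r := by linarith
  have hs1 : 1.414 * r ≤ s := by
    rw [hs]
    apply Real.le_sqrt_of_sq_le
    rw [← div_div, ← hrs, le_div_iff₀ hp]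
    nlinarith [sq_nonneg r, mul_pos hr0 (mul_pos hr0 hr0)]
  unfold KK
  rw [← hs, ← hr]
  have e : Real.exp (-(25 * r)) = Real.exp (-(25 * s)) * Real.exp (25 * (s - r)) := by
    rw [← Real.exp_add]; congr 1; ring
  rw [e]
  have hx : 10.35 * r ≤ 25 * (s - r) := by linarith
  have h1 : 1 + 10.35 * r + (10.35 * r) ^ 2 / 2 ≤ Real.exp (25 * (s - r)) :=
    (Real.quadratic_le_exp_of_nonneg (by positivity)).trans (Real.exp_le_exp.2 hx)
  have h2 : (1 / 2 + 2 * r) ≤ (1 + 10.35 * r + (10.35 * r) ^ 2 / 2) * (1 / 2 - 2 * r) := by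
    nlinarith [mul_pos hr0 hr0, mul_nonneg hr0.le (sub_nonneg.2 hr1),
      mul_nonneg (mul_pos hr0 hr0).le (sub_nonneg.2 hr1)]
  have h3 := h2.trans (mul_le_mul_of_nonneg_right h1 hp.le)
  have := mul_le_mul_of_nonneg_left h3 (Real.exp_pos (-(25 * s))).le
  linarith

lemma exp_const : (1 : ℝ) / 13 ≤ Real.exp (-(5 / 2)) := by
  have h := Real.exp_one_lt_d9
  have h5 : Real.exp (5 / 2) ^ 2 = Real.exp 1 ^ 5 := by
    rw [← Real.exp_nat_mul, ← Real.exp_nat_mul]; norm_num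
  have h6 : Real.exp 1 ^ 5 ≤ 2.7182818286 ^ 5 := by gcongr
  have h7 : Real.exp (5 / 2) ≤ 13 := by
    apply le_of_sq_le_sq _ (by norm_num)
    rw [h5]; exact h6.trans (by norm_num)
  rw [Real.exp_neg, one_div]
  exact inv_anti₀ (Real.exp_pos _) h7

lemma KK_stop (δ α r : ℝ) (hδ : 0 < δ) (hα : 100 * δ < α) (hr : r = √(δ / α))
    (hs : α * (1 / 2 - 2 * r) ≤ 100 * δ) :
    α * (1 / 2 + 2 * r) ≤ KK δ α * δ := by
  have hα0 : 0 < α := by linarith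
  have hr0 : 0 < r := by rw [hr]; positivity
  have hr1 : r ≤ 1 / 10 := by
    rw [hr, Real.sqrt_le_left (by norm_num), div_le_iff₀ hα0]; linarith
  have h1 : (1 : ℝ) / 13 ≤ Real.exp (-(25 * r)) :=
    exp_const.trans (Real.exp_le_exp.2 (by linarith))
  unfold KK
  rw [← hr]
  nlinarith [mul_le_mul_of_nonneg_right h1 hδ.le, mul_nonneg hα0.le (sub_nonneg.2 hr1)]

lemma iterate {q p : ℕ} (z : Fin q → Fin p → ℂ) (δ : ℝ) (hδ : 0 < δ)
    (hz : ∀ i, ∑ k, ‖z i k‖ ^ 2 ≤ δ) (n : ℕ) :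
    ∀ (α β : ℝ) (J₀ : Finset (Fin q)), α ≤ 100 * 2 ^ n * δ → 100 * δ < α → α ≤ β →
    ((∑ i ∈ J₀, rankOneMatrix (z i)) - (α : ℂ) • 1).PosSemidef →
    ((β : ℂ) • 1 - ∑ i ∈ J₀, rankOneMatrix (z i)).PosSemidef →
    ∃ (t : ℕ) (J : Fin t → Finset (Fin q)),
      (∀ i ∈ J₀, ∃! s : Fin t, i ∈ J s) ∧ (∀ s, J s ⊆ J₀) ∧
      ∀ s : Fin t,
        ((∑ i ∈ J s, rankOneMatrix (z i)) -
          ((25 * δ : ℝ) : ℂ) • (1 : Matrix (Fin p) (Fin p) ℂ)).PosSemidef ∧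
        (((KK δ α * (β / α) * δ : ℝ) : ℂ) • (1 : Matrix (Fin p) (Fin p) ℂ) -
          ∑ i ∈ J s, rankOneMatrix (z i)).PosSemidef := by
  induction n with
  | zero => intro α β J₀ h1 h2; exfalso; norm_num at h1; linarith
  | succ n ih =>
    intro α β J₀ h1 h2 hab hlow hup
    have hα0 : 0 < α := by linarith
    have hβ0 : 0 < β := by linarith
    obtain ⟨σ, hσ⟩ := split_two z J₀ α β δ hα0 hδ (by linarith) hz hlow hup
    obtain ⟨r, hr⟩ : ∃ r, r = √(δ / α) := ⟨_, rfl⟩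
    rw [← hr] at hσ
    have hr0 : 0 < r := by rw [hr]; positivity
    have hr1 : r ≤ 1 / 10 := by
      rw [hr, Real.sqrt_le_left (by norm_num), div_le_iff₀ hα0]; linarith
    have hp : 0 < 1 / 2 - 2 * r := by linarith
    by_cases hs : α * (1 / 2 - 2 * r) ≤ 100 * δ
    · refine ⟨2, fun s => J₀.filter (fun i => σ i = decide (s = 1)), ?_, ?_, ?_⟩
      · intro i hi
        refine ⟨if σ i then 1 else 0, ?_, ?_⟩
        · by_cases h : σ i <;> simp [hi, h]
        · intro s h
          have h := (Finset.mem_filter.mp h).2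
          rw [h]
          fin_cases s <;> simp
      · intro s; exact Finset.filter_subset _ _
      · intro s
        obtain ⟨ha, hb⟩ := hσ (decide (s = 1))
        refine ⟨psd_lower_mono _ _ _ ?_ ha, psd_upper_mono _ _ _ ?_ hb⟩
        · nlinarith [mul_nonneg hα0.le (sub_nonneg.2 hr1)]
        · have := mul_le_mul_of_nonneg_left (KK_stop δ α r hδ h2 hr hs)
            (div_nonneg hβ0.le hα0.le)
          have e : β / α * (α * (1 / 2 + 2 * r)) = β * (1 / 2 + 2 * r) := by field_simp
          rw [e] at this
          linarith
    · push Not at hs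
      have key : ∀ b, _ := fun b => ih (α * (1 / 2 - 2 * r)) (β * (1 / 2 + 2 * r))
        (J₀.filter (fun i => σ i = b)) (by
          rw [pow_succ] at h1
          nlinarith [mul_pos hα0 hr0]) hs (by nlinarith [mul_pos hα0 hr0, mul_pos hβ0 hr0])
          (hσ b).1 (hσ b).2
      have hK : KK δ (α * (1 / 2 - 2 * r)) * (β * (1 / 2 + 2 * r) / (α * (1 / 2 - 2 * r))) * δ
          ≤ KK δ α * (β / α) * δ := by
        have e : KK δ (α * (1 / 2 - 2 * r)) * (β * (1 / 2 + 2 * r) / (α * (1 / 2 - 2 * r)))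
          = (KK δ (α * (1 / 2 - 2 * r)) * (1 / 2 + 2 * r)) / (1 / 2 - 2 * r) * (β / α) := by
          field_simp
        rw [e]
        have h' := KK_step δ α r hδ h2 hr
        rw [← div_le_iff₀ hp] at h'
        gcongr
      obtain ⟨t0, A, hA1, hA2, hA3⟩ := key false
      obtain ⟨t1, B, hB1, hB2, hB3⟩ := key true
      have hA2' : ∀ s i, i ∈ A s → σ i = false := fun s i h => (Finset.mem_filter.mp (hA2 s h)).2
      have hB2' : ∀ s i, i ∈ B s → σ i = true := fun s i h => (Finset.mem_filter.mp (hB2 s h)).2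
      refine ⟨t0 + t1, Fin.append A B, ?_, ?_, ?_⟩
      · intro i hi
        cases hb : σ i
        · obtain ⟨s, hs1, hs2⟩ := hA1 i (by simp [hi, hb])
          refine ⟨Fin.castAdd t1 s, by simpa using hs1, ?_⟩
          intro u
          refine Fin.addCases (fun v hv => ?_) (fun v hv => ?_) u
          · simp only [Fin.append_left] at hv
            rw [hs2 v hv]
          · simp only [Fin.append_right] at hv
            have := hB2' v i hv
            simp [hb] at this
        · obtain ⟨s, hs1, hs2⟩ := hB1 i (by simp [hi, hb])
          refine ⟨Fin.natAdd t0 s, by simpa using hs1, ?_⟩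
          intro u
          refine Fin.addCases (fun v hv => ?_) (fun v hv => ?_) u
          · simp only [Fin.append_left] at hv
            have := hA2' v i hv
            simp [hb] at this
          · simp only [Fin.append_right] at hv
            rw [hs2 v hv]
      · intro u
        refine Fin.addCases (fun v => ?_) (fun v => ?_) u
        · rw [Fin.append_left]; exact (hA2 v).trans (Finset.filter_subset _ _)
        · rw [Fin.append_right]; exact (hB2 v).trans (Finset.filter_subset _ _)
      · intro u
        refine Fin.addCases (fun v => ?_) (fun v => ?_) u
        · rw [Fin.append_left]; exact ⟨(hA3 v).1, psd_upper_mono _ _ _ hK (hA3 v).2⟩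
        · rw [Fin.append_right]; exact ⟨(hB3 v).1, psd_upper_mono _ _ _ hK (hB3 v).2⟩

end MSS

theorem statement12 (p q : ℕ) (δ α β : ℝ)
    (z : Fin q → Fin p → ℂ)
    -- `‖z_i‖₂² ≤ δ`
    (hz : ∀ i, ∑ k, ‖z i k‖ ^ 2 ≤ δ)
    -- `β ≥ α > 100 δ > 0`
    (hδ : 0 < δ) (hα : 100 * δ < α) (hβ : α ≤ β)
    -- `α I_p ≤ ∑ z_i z_i* ≤ β I_p` (Loewner order)
    (hlow : ((∑ i, rankOneMatrix (z i)) - (α : ℂ) • (1 : Matrix (Fin p) (Fin p) ℂ)).PosSemidef)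
    (hup : ((β : ℂ) • (1 : Matrix (Fin p) (Fin p) ℂ) - ∑ i, rankOneMatrix (z i)).PosSemidef) :
    ∃ (t : ℕ) (J : Fin t → Finset (Fin q)),
      -- the `J s` form a partition of `{1,…,q}`
      (∀ i : Fin q, ∃! s : Fin t, i ∈ J s) ∧
      ∀ s : Fin t,
        ((∑ i ∈ J s, rankOneMatrix (z i)) -
          ((25 * δ : ℝ) : ℂ) • (1 : Matrix (Fin p) (Fin p) ℂ)).PosSemidef ∧
        (((3600 * (β / α) * δ : ℝ) : ℂ) • (1 : Matrix (Fin p) (Fin p) ℂ) -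
          ∑ i ∈ J s, rankOneMatrix (z i)).PosSemidef := by
  obtain ⟨n, hn⟩ := pow_unbounded_of_one_lt (α / (100 * δ)) (one_lt_two (α := ℝ))
  rw [div_lt_iff₀ (by positivity)] at hn
  obtain ⟨t, J, h1, _, h3⟩ := MSS.iterate z δ hδ hz n α β Finset.univ (by linarith) hα hβ hlow hup
  refine ⟨t, J, fun i => h1 i (Finset.mem_univ _), fun s => ⟨(h3 s).1, ?_⟩⟩
  refine MSS.psd_upper_mono _ _ _ ?_ (h3 s).2
  have hα0 : 0 < α := by linarith
  have hβ0 : 0 < β := by linarith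
  have : MSS.KK δ α ≤ 3600 := by
    have : Real.exp (-(25 * √(δ / α))) ≤ 1 := Real.exp_le_one_iff.2 (by
      have := Real.sqrt_nonneg (δ / α)
      linarith)
    unfold MSS.KK
    linarith
  gcongr

end
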